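/- For every l ≥ 1, the bound in the preimage theorem is sharp: the filling T(l) of (∞^l) defined by T(l)_{i,j} = i + #{ (i',j') : 1 ≤ i' ≤ l, j' ≥ 1, i' + j' < i + j } (filling the shape along antidiagonals, each antidiagonal from top to bottom with the smallest available entries) is an infinite standard Young tableau of shape (∞^l), and the number of tableaux U ∈ SYT((∞^l)) with jdt(U) = T(l) equals exactly l. -/

import Mathlib

open scoped Classical

/-- A 0-based box `(i, j)` belongs to the infinite shape with `l` rows
(`l = ⊤` gives the shape `(∞^∞)`, `l = (l₀ : ℕ∞)` gives `(∞^l₀)`).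
Throughout, boxes are 0-based: the paper's box `(i, j)` (with row `i ≥ 1` and
column `j ≥ 1`) corresponds to `(i - 1, j - 1)`. -/
def Box (l : ℕ∞) (b : ℕ × ℕ) : Prop := (b.1 : ℕ∞) < l

/-- `T` is an infinite standard Young tableau of the shape given by `Box l`:
entries are positive integers on the shape (and the junk value `0` off the shape),
`T` is a bijection from the boxes of the shape onto the positive integers, and
`T` is strictly increasing along rows and columns. -/
structure IsSYT (l : ℕ∞) (T : ℕ × ℕ → ℕ) : Prop where
  zero_outside : ∀ b : ℕ × ℕ, ¬ Box l b → T b = 0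
  pos : ∀ b : ℕ × ℕ, Box l b → 0 < T b
  inj : ∀ b c : ℕ × ℕ, Box l b → Box l c → T b = T c → b = c
  surj : ∀ n : ℕ, 0 < n → ∃ b : ℕ × ℕ, Box l b ∧ T b = n
  row_lt : ∀ b : ℕ × ℕ, Box l b → T b < T (b.1, b.2 + 1)
  col_lt : ∀ b : ℕ × ℕ, Box l (b.1 + 1, b.2) → T b < T (b.1 + 1, b.2)

/-- The sliding path of the filling `T` inside the set `D` of boxes, started at the
box `c`: at each step the empty box moves to whichever of the boxes directly below
or directly to the right (among those belonging to `D`) carries the smaller entry;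
if neither belongs to `D`, the path stays put (it has terminated). -/
noncomputable def slideFrom (D : ℕ × ℕ → Prop) (T : ℕ × ℕ → ℕ) (c : ℕ × ℕ) : ℕ → ℕ × ℕ
  | 0 => c
  | n + 1 =>
      let b := slideFrom D T c n
      if D (b.1 + 1, b.2) ∧ D (b.1, b.2 + 1) then
        (if T (b.1 + 1, b.2) < T (b.1, b.2 + 1) then (b.1 + 1, b.2) else (b.1, b.2 + 1))
      else if D (b.1 + 1, b.2) then (b.1 + 1, b.2)
      else if D (b.1, b.2 + 1) then (b.1, b.2 + 1)
      else b

/-- The sliding path `p(T)`, 0-indexed: `slide D T n` is the paper's `p_{n+1}(T)`;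
it lies on the antidiagonal `i + j = n` as long as the path has not terminated. -/
noncomputable def slide (D : ℕ × ℕ → Prop) (T : ℕ × ℕ → ℕ) : ℕ → ℕ × ℕ :=
  slideFrom D T (0, 0)

/-- Jeu de taquin on the set of boxes `D`: the entry `1` in the box `(0,0)` is
deleted, entries slide backwards along the sliding path, and every entry is
decremented by `1`.  A box `b` lies on the sliding path iff
`slide D T (b.1 + b.2) = b`; if moreover the path terminates at `b` (which is only
possible for finite tableaux) the box `b` is vacated (junk value `0`). -/
noncomputable def jdt (D : ℕ × ℕ → Prop) (T : ℕ × ℕ → ℕ) : ℕ × ℕ → ℕ := fun b =>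
  if slide D T (b.1 + b.2) = b then
    (if slide D T (b.1 + b.2 + 1) = b then 0
     else T (slide D T (b.1 + b.2 + 1)) - 1)
  else T b - 1

/-- The tableau `T(l)` filling the shape `(∞^l)` along antidiagonals: in 1-based
coordinates, `T(l)_{i,j} = i + #{(i',j') : 1 ≤ i' ≤ l, j' ≥ 1, i' + j' < i + j}`.
Here everything is 0-based. -/
noncomputable def Tdiag (l : ℕ) : ℕ × ℕ → ℕ := fun b =>
  if b.1 < l then
    b.1 + 1 + {p : ℕ × ℕ | p.1 < l ∧ p.1 + p.2 < b.1 + b.2}.ncard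
  else 0

theorem box_iff (l : ℕ) (b : ℕ × ℕ) : Box (l : ℕ∞) b ↔ b.1 < l := by
  simp [Box]

noncomputable def NN (l d : ℕ) : ℕ := {p : ℕ × ℕ | p.1 < l ∧ p.1 + p.2 < d}.ncard

theorem NN_fin (l d : ℕ) : {p : ℕ × ℕ | p.1 < l ∧ p.1 + p.2 < d}.Finite := by
  apply ((Set.finite_Iio l).prod (Set.finite_Iio d)).subset
  rintro ⟨a, b⟩ h
  simp at h ⊢
  omega

theorem NN_zero (l : ℕ) : NN l 0 = 0 := by simp [NN]

theorem NN_succ (l d : ℕ) : NN l (d+1) = NN l d + min l (d+1) := by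
  unfold NN
  have h : {p : ℕ × ℕ | p.1 < l ∧ p.1 + p.2 < d + 1} =
      {p : ℕ × ℕ | p.1 < l ∧ p.1 + p.2 < d} ∪
        (fun i : ℕ => (i, d - i)) '' (Finset.range (min l (d+1)) : Set ℕ) := by
    ext ⟨a, b⟩
    simp only [Set.mem_setOf_eq, Set.mem_union, Set.mem_image, Finset.coe_range, Set.mem_Iio,
      Prod.mk.injEq]
    constructor
    · intro h
      by_cases h' : a + b < d
      · left; omega
      · right; exact ⟨a, by omega, rfl, by omega⟩
    · rintro (h | ⟨i, h1, h2, h3⟩) <;> omega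
  rw [h, Set.ncard_union_eq _ (NN_fin l d) ((Finset.finite_toSet _).image _),
    Set.ncard_image_of_injective, Set.ncard_coe_finset, Finset.card_range]
  · intro a b h
    simp at h
    exact h.1
  · rw [Set.disjoint_left]
    rintro ⟨a, b⟩ h1 ⟨i, h2, h3⟩
    simp at h1 h2 h3
    omega

theorem NN_lt (l : ℕ) {d d' : ℕ} (h : d < d') : NN l d + min l (d+1) ≤ NN l d' := by
  rw [← NN_succ]
  exact monotone_nat_of_le_succ (fun n => by rw [NN_succ]; omega) h

theorem T_eq {l i j : ℕ} (h : i < l) : Tdiag l (i, j) = i + 1 + NN l (i + j) := by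
  simp [Tdiag, h, NN]

theorem T_diag {l i j i' j' : ℕ} (h' : i' < l) (hd : i + j = i' + j')
    (hi : i < i') : Tdiag l (i, j) < Tdiag l (i', j') := by
  rw [T_eq (by omega), T_eq h', hd]; omega

theorem T_lt {l i j i' j' : ℕ} (h : i < l) (h' : i' < l) (hd : i + j < i' + j') :
    Tdiag l (i, j) < Tdiag l (i', j') := by
  have := NN_lt l hd
  rw [T_eq h, T_eq h']; omega

theorem T_inj {l i j i' j' : ℕ} (h : i < l) (h' : i' < l)
    (he : Tdiag l (i, j) = Tdiag l (i', j')) : i = i' ∧ j = j' := by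
  rcases lt_trichotomy (i + j) (i' + j') with hd | hd | hd
  · have := T_lt h h' hd; omega
  · rcases lt_trichotomy i i' with hi | hi | hi
    · have := T_diag h' hd hi; omega
    · omega
    · have := T_diag h hd.symm hi; omega
  · have := T_lt h' h hd; omega

theorem T_surj {l : ℕ} (hl : 1 ≤ l) (n : ℕ) (hn : 0 < n) :
    ∃ i j, i < l ∧ Tdiag l (i, j) = n := by
  have hex : ∃ d, n ≤ NN l d := by
    refine ⟨n, ?_⟩
    clear hn
    induction n with
    | zero => omega
    | succ k ih => rw [NN_succ]; omega
  obtain ⟨d, hd, hmin⟩ : ∃ d, n ≤ NN l (d+1) ∧ NN l d < n := by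
    have h1 := Nat.find_spec hex
    rcases hD : Nat.find hex with _ | d
    · rw [hD, NN_zero] at h1; omega
    · rw [hD] at h1
      exact ⟨d, h1, by
        have := Nat.find_min hex (m := d) (by omega)
        omega⟩
  rw [NN_succ] at hd
  refine ⟨n - NN l d - 1, d - (n - NN l d - 1), by omega, ?_⟩
  rw [T_eq (by omega), show n - NN l d - 1 + (d - (n - NN l d - 1)) = d by omega]
  omega

theorem T_syt {l : ℕ} (hl : 1 ≤ l) : IsSYT (l : ℕ∞) (Tdiag l) := by
  constructor
  · intro b hb
    rw [box_iff] at hb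
    simp [Tdiag, hb]
  · rintro ⟨i, j⟩ hb
    rw [box_iff] at hb
    rw [T_eq hb]; omega
  · rintro ⟨i, j⟩ ⟨i', j'⟩ hb hc h
    rw [box_iff] at hb hc
    have := T_inj hb hc h
    exact Prod.ext this.1 this.2
  · intro n hn
    obtain ⟨i, j, h1, h2⟩ := T_surj hl n hn
    exact ⟨(i, j), (box_iff _ _).2 h1, h2⟩
  · rintro ⟨i, j⟩ hb
    rw [box_iff] at hb
    exact T_lt hb hb (by simp)
  · rintro ⟨i, j⟩ hb
    rw [box_iff] at hb
    simp at hb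
    exact T_lt (by omega) hb (by simp)

/-- the `r`-th sliding path -/
def PP (r n : ℕ) : ℕ × ℕ := if n ≤ r then (n, 0) else (r, n - r)

/-- predecessor on the path, identity off the path -/
def QQ (r : ℕ) (b : ℕ × ℕ) : ℕ × ℕ :=
  if b.2 = 0 ∧ b.1 ≤ r then (b.1 - 1, 0)
  else if b.1 = r then (r, b.2 - 1) else b

/-- the `r`-th preimage -/
noncomputable def UU (l r : ℕ) (b : ℕ × ℕ) : ℕ :=
  if b.1 < l then (if b = (0, 0) then 1 else Tdiag l (QQ r b) + 1) else 0

theorem UU_zero {l r : ℕ} (hl : 1 ≤ l) : UU l r (0, 0) = 1 := by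
  have : 0 < l := hl
  simp [UU, this]

theorem UU_col {l r i : ℕ} (hr : r < l) (h : i + 1 ≤ r) :
    UU l r (i + 1, 0) = Tdiag l (i, 0) + 1 := by
  have : i + 1 < l := by omega
  simp [UU, QQ, this, h]

theorem UU_row {l r j : ℕ} (hr : r < l) :
    UU l r (r, j + 1) = Tdiag l (r, j) + 1 := by
  simp [UU, QQ, hr]

theorem UU_off {l r i j : ℕ} (hi : i < l) (h1 : ¬ (j = 0 ∧ i ≤ r)) (h2 : i ≠ r) :
    UU l r (i, j) = Tdiag l (i, j) + 1 := by
  have : ¬ (i = 0 ∧ j = 0) := by omega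
  simp [UU, QQ, h1, h2, hi, this]

theorem UU_cases {l r : ℕ} (hr : r < l) (i j : ℕ) (hi : i < l) :
    (i = 0 ∧ j = 0 ∧ UU l r (i, j) = 1) ∨
    (∃ k, i = k + 1 ∧ j = 0 ∧ i ≤ r ∧ UU l r (i, j) = Tdiag l (k, 0) + 1) ∨
    (∃ k, i = r ∧ j = k + 1 ∧ UU l r (i, j) = Tdiag l (r, k) + 1) ∨
    (¬ (j = 0 ∧ i ≤ r) ∧ i ≠ r ∧ UU l r (i, j) = Tdiag l (i, j) + 1) := by
  by_cases h1 : j = 0 ∧ i ≤ r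
  · obtain ⟨rfl, h1⟩ := h1
    rcases i with _ | k
    · left; exact ⟨rfl, rfl, UU_zero (by omega)⟩
    · right; left; exact ⟨k, rfl, rfl, h1, UU_col hr h1⟩
  · right; right
    by_cases h2 : i = r
    · left
      rcases j with _ | k
      · omega
      · subst h2; exact ⟨k, rfl, rfl, UU_row hr⟩
    · right; exact ⟨h1, h2, UU_off hi h1 h2⟩

theorem T_pos {l i j : ℕ} (h : i < l) : 0 < Tdiag l (i, j) := by
  rw [T_eq h]; omega

theorem UU_syt {l r : ℕ} (hr : r < l) : IsSYT (l : ℕ∞) (UU l r) := by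
  constructor
  · intro b hb
    rw [box_iff] at hb
    simp [UU, hb]
  · rintro ⟨i, j⟩ hb
    rw [box_iff] at hb
    rcases UU_cases hr i j hb with h | ⟨k, h⟩ | ⟨k, h⟩ | h <;> omega
  · rintro ⟨i, j⟩ ⟨i', j'⟩ hb hc h
    rw [box_iff] at hb hc
    simp only at hb hc
    rw [Prod.mk.injEq]
    rcases UU_cases hr i j hb with ⟨h1, h2, h3⟩ | ⟨k, h1, h2, h3, h4⟩ | ⟨k, h1, h2, h3⟩ | ⟨h1, h2, h3⟩ <;>
    rcases UU_cases hr i' j' hc with ⟨g1, g2, g3⟩ | ⟨m, g1, g2, g3, g4⟩ | ⟨m, g1, g2, g3⟩ | ⟨g1, g2, g3⟩ <;>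
    grind [T_pos, T_inj]
  · intro n hn
    by_cases h1 : n = 1
    · exact ⟨(0, 0), (box_iff _ _).2 (by simp; omega), by rw [h1]; exact UU_zero (by omega)⟩
    obtain ⟨i, j, hi, hT⟩ := T_surj (l := l) (by omega) (n - 1) (by omega)
    by_cases h1 : j = 0 ∧ i + 1 ≤ r
    · obtain ⟨rfl, h1⟩ := h1
      exact ⟨(i + 1, 0), (box_iff _ _).2 (by simp; omega), by rw [UU_col hr h1]; omega⟩
    · by_cases h2 : i = r
      · subst h2
        exact ⟨(i, j + 1), (box_iff _ _).2 hr, by rw [UU_row hr]; omega⟩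
      · exact ⟨(i, j), (box_iff _ _).2 hi, by rw [UU_off hi (by omega) h2]; omega⟩
  · rintro ⟨i, j⟩ hb
    rw [box_iff] at hb
    simp only at hb ⊢
    rcases UU_cases hr i j hb with ⟨h1, h2, hh⟩ | ⟨k, h1, h2, h3, hh⟩ | ⟨k, h1, h2, hh⟩ | ⟨h1, h2, hh⟩ <;>
    rcases UU_cases hr i (j+1) hb with ⟨g1, g2, gg⟩ | ⟨m, g1, g2, g3, gg⟩ | ⟨m, g1, g2, gg⟩ | ⟨g1, g2, gg⟩ <;>
    first
    | (exfalso; omega)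
    | (rw [hh, gg]; exact Nat.succ_lt_succ (T_lt (by omega) (by omega) (by omega)))
    | (rw [hh, gg]; exact Nat.succ_lt_succ (T_diag (by omega) (by omega) (by omega)))
    | (rw [hh, gg]; exact Nat.succ_lt_succ (T_pos (by omega)))
  · rintro ⟨i, j⟩ hb
    rw [box_iff] at hb
    simp only at hb ⊢
    rcases UU_cases hr i j (by omega) with ⟨h1, h2, hh⟩ | ⟨k, h1, h2, h3, hh⟩ | ⟨k, h1, h2, hh⟩ | ⟨h1, h2, hh⟩ <;>
    rcases UU_cases hr (i+1) j hb with ⟨g1, g2, gg⟩ | ⟨m, g1, g2, g3, gg⟩ | ⟨m, g1, g2, gg⟩ | ⟨g1, g2, gg⟩ <;>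
    first
    | (exfalso; omega)
    | (rw [hh, gg]; exact Nat.succ_lt_succ (T_lt (by omega) (by omega) (by omega)))
    | (rw [hh, gg]; exact Nat.succ_lt_succ (T_diag (by omega) (by omega) (by omega)))
    | (rw [hh, gg]; exact Nat.succ_lt_succ (T_pos (by omega)))

theorem slide_succ (l : ℕ) (U : ℕ × ℕ → ℕ) (n i j : ℕ) (hi : i < l)
    (h : slide (Box (l : ℕ∞)) U n = (i, j)) :
    slide (Box (l : ℕ∞)) U (n + 1) =
      if i + 1 < l ∧ U (i + 1, j) < U (i, j + 1) then (i + 1, j) else (i, j + 1) := by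
  unfold slide at *
  rw [slideFrom, h]
  simp only [box_iff]
  by_cases h1 : i + 1 < l <;> simp [h1, hi]

theorem slide_UU {l r : ℕ} (hr : r < l) (n : ℕ) :
    slide (Box (l : ℕ∞)) (UU l r) n = PP r n := by
  induction n with
  | zero => simp [slide, slideFrom, PP]
  | succ n ih =>
    by_cases h : n ≤ r
    · have hp : PP r n = (n, 0) := by simp [PP, h]
      rw [hp] at ih
      rw [slide_succ l _ n n 0 (by omega) ih]
      by_cases h2 : n + 1 ≤ r
      · rw [if_pos, PP, if_pos h2]
        refine ⟨by omega, ?_⟩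
        rw [UU_col hr h2, UU_off (by omega) (by omega) (by omega)]
        have := T_lt (l := l) (i := n) (i' := n) (j := 0) (j' := 1) (by omega) (by omega) (by omega)
        simpa using this
      · obtain rfl : n = r := by omega
        rw [if_neg, PP, if_neg h2]
        · simp
        · rintro ⟨h3, h4⟩
          rw [UU_row hr, UU_off h3 (by omega) (by omega)] at h4
          have := T_lt (l := l) (i := n) (i' := n + 1) (j := 0) (j' := 0) hr h3 (by omega)
          omega
    · have hp : PP r n = (r, n - r) := by simp [PP, h]
      rw [hp] at ih
      rw [slide_succ l _ n _ _ hr ih, if_neg, PP, if_neg (by omega)]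
      · congr 1; omega
      · rintro ⟨h3, h4⟩
        rw [UU_row hr, UU_off h3 (by omega) (by omega)] at h4
        have := T_lt (l := l) (i := r) (i' := r + 1) (j := n - r) (j' := n - r) hr h3 (by omega)
        omega

theorem jdt_UU {l r : ℕ} (hr : r < l) : jdt (Box (l : ℕ∞)) (UU l r) = Tdiag l := by
  funext ⟨i, j⟩
  simp only [jdt, slide_UU hr]
  by_cases hon : PP r (i + j) = (i, j)
  · have hne : PP r (i + j + 1) ≠ (i, j) := by
      unfold PP; split_ifs <;> simp <;> omega
    rw [if_pos hon, if_neg hne]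
    unfold PP at hon ⊢
    by_cases h2 : i + j ≤ r
    · rw [if_pos h2] at hon
      obtain rfl : j = 0 := by simp at hon; omega
      by_cases h3 : i + 0 + 1 ≤ r
      · rw [if_pos h3, add_zero, UU_col hr h3]; rfl
      · obtain rfl : i = r := by omega
        rw [if_neg h3, show i + 0 + 1 - i = 0 + 1 by omega, UU_row hr]; rfl
    · rw [if_neg h2] at hon
      obtain rfl : r = i := by simp at hon; omega
      rw [if_neg (by omega), show r + j + 1 - r = j + 1 by omega, UU_row hr]; rfl
  · rw [if_neg hon]
    by_cases hi : i < l
    · rw [UU_off hi]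
      · rfl
      · rintro ⟨rfl, h⟩; apply hon; simp [PP, h]
      · rintro rfl
        apply hon
        unfold PP
        split_ifs with h
        · simp; omega
        · simp
    · simp [UU, Tdiag, hi]

theorem slide_inv {l : ℕ} (hl : 1 ≤ l) (U : ℕ × ℕ → ℕ) (n : ℕ) :
    (slide (Box (l : ℕ∞)) U n).1 < l ∧
      (slide (Box (l : ℕ∞)) U n).1 + (slide (Box (l : ℕ∞)) U n).2 = n := by
  induction n with
  | zero => simp [slide, slideFrom]; omega
  | succ n ih =>
    rcases h : slide (Box (l : ℕ∞)) U n with ⟨i, j⟩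
    rw [h] at ih
    simp only at ih
    rw [slide_succ l U n i j ih.1 h]
    split_ifs <;> simp <;> omega

theorem no_down {l : ℕ} (hl : 1 ≤ l) {U : ℕ × ℕ → ℕ} (hU : IsSYT (l : ℕ∞) U)
    (hj : jdt (Box (l : ℕ∞)) U = Tdiag l) (n i j : ℕ)
    (h : slide (Box (l : ℕ∞)) U n = (i, j + 1)) :
    slide (Box (l : ℕ∞)) U (n + 1) = (i, j + 2) := by
  have hv := slide_inv hl U n
  rw [h] at hv
  simp only at hv
  have hs := slide_succ l U n i (j + 1) hv.1 h
  split_ifs at hs with hc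
  · exfalso
    have e1 := congrFun hj (i, j + 1)
    have e2 := congrFun hj (i + 1, j)
    simp only [jdt] at e1 e2
    rw [show i + 1 + j = n by omega, h] at e2
    rw [hv.2, h, hs] at e1
    simp at e1 e2
    have h3 := hU.row_lt (i + 1, j) ((box_iff _ _).2 hc.1)
    have h4 := T_diag (l := l) (i := i) (i' := i + 1) (j := j + 1) (j' := j) hc.1 (by omega) (by omega)
    simp only at h3
    omega
  · exact hs

theorem slide_form {l : ℕ} (hl : 1 ≤ l) {U : ℕ × ℕ → ℕ} (hU : IsSYT (l : ℕ∞) U)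
    (hj : jdt (Box (l : ℕ∞)) U = Tdiag l) :
    ∃ r < l, ∀ n, slide (Box (l : ℕ∞)) U n = PP r n := by
  have hex : ∃ n, slide (Box (l : ℕ∞)) U (n + 1) ≠ (n + 1, 0) := by
    by_contra! hcon
    have := (slide_inv hl U (l + 1)).1
    rw [hcon] at this
    simp at this
  have hmin : ∀ m ≤ Nat.find hex, slide (Box (l : ℕ∞)) U m = (m, 0) := by
    intro m hm
    rcases m with _ | m
    · rfl
    · exact not_not.1 (Nat.find_min hex (m := m) (by omega))
  have hspec := Nat.find_spec hex
  generalize Nat.find hex = r at hmin hspec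
  have hr : r < l := by
    have := (slide_inv hl U r).1
    rwa [hmin r le_rfl] at this
  refine ⟨r, hr, ?_⟩
  have hrow : ∀ k, slide (Box (l : ℕ∞)) U (r + 1 + k) = (r, k + 1) := by
    intro k
    induction k with
    | zero =>
      have hs := slide_succ l U r r 0 hr (hmin r le_rfl)
      split_ifs at hs with hc
      · exact absurd hs hspec
      · exact hs
    | succ k ih => exact no_down hl hU hj _ _ _ ih
  intro n
  unfold PP
  split_ifs with h
  · exact hmin n h
  · have := hrow (n - r - 1)
    rw [show r + 1 + (n - r - 1) = n by omega] at this
    rw [this]; congr 1; omega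

theorem U_one {l : ℕ} (hl : 1 ≤ l) {U : ℕ × ℕ → ℕ} (hU : IsSYT (l : ℕ∞) U) : U (0, 0) = 1 := by
  obtain ⟨⟨i, j⟩, hb, h1⟩ := hU.surj 1 one_pos
  rw [box_iff] at hb
  simp only at hb
  rcases i with _ | i
  · rcases j with _ | j
    · exact h1
    · have h2 := hU.row_lt (0, j) ((box_iff _ _).2 hb)
      have h3 := hU.pos (0, j) ((box_iff _ _).2 hb)
      simp only at h2
      omega
  · have h2 := hU.col_lt (i, j) ((box_iff _ _).2 hb)
    have h3 := hU.pos (i, j) ((box_iff _ _).2 (by simp; omega))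
    simp only at h2
    omega

theorem U_form {l : ℕ} (hl : 1 ≤ l) {U : ℕ × ℕ → ℕ} (hU : IsSYT (l : ℕ∞) U)
    (hj : jdt (Box (l : ℕ∞)) U = Tdiag l) : ∃ r < l, UU l r = U := by
  obtain ⟨r, hr, hp⟩ := slide_form hl hU hj
  refine ⟨r, hr, ?_⟩
  have key : ∀ i j, (if PP r (i + j) = (i, j) then
      (if PP r (i + j + 1) = (i, j) then 0 else U (PP r (i + j + 1)) - 1)
      else U (i, j) - 1) = Tdiag l (i, j) := by
    intro i j
    have := congrFun hj (i, j)
    simpa only [jdt, hp] using this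
  funext ⟨i, j⟩
  by_cases hi : i < l
  · have hpos := hU.pos (i, j) ((box_iff _ _).2 hi)
    rcases UU_cases hr i j hi with ⟨h1, h2, h3⟩ | ⟨k, h1, h2, h3, h4⟩ | ⟨k, h1, h2, h3⟩ | ⟨h1, h2, h3⟩
    · rw [h3, h1, h2, U_one hl hU]
    · have := key k 0
      have e1 : PP r (k + 0) = (k, 0) := by rw [PP, if_pos (by omega)]; rfl
      have e2 : PP r (k + 0 + 1) = (i, j) := by rw [PP, if_pos (by omega), h1, h2]
      rw [if_pos e1, e2, if_neg (by simp; omega)] at this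
      omega
    · have := key r k
      have e1 : PP r (r + k) = (r, k) := by
        unfold PP; split_ifs
        · simp; omega
        · simp
      have e2 : PP r (r + k + 1) = (i, j) := by
        rw [PP, if_neg (by omega), h1, h2]; simp; omega
      rw [if_pos e1, e2, if_neg (by simp; omega)] at this
      omega
    · have := key i j
      rw [if_neg] at this
      · omega
      · unfold PP
        split_ifs <;> simp <;> omega
  · rw [hU.zero_outside (i, j) (by rw [box_iff]; exact hi)]
    simp [UU, hi]

theorem UU_inj {l r s : ℕ} (hr : r < l) (hs : s < l) (h : UU l r = UU l s) : r = s := by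
  have h1 := slide_UU hr (r + s + 1)
  rw [h, slide_UU hs, PP, PP, if_neg (by omega), if_neg (by omega)] at h1
  simp at h1
  omega

/-- For every `l ≥ 1`, the antidiagonal filling `T(l)` is an infinite standard
Young tableau of shape `(∞^l)` having exactly `l` preimages under jeu de taquin;
in particular the upper bound `l` on the number of preimages is sharp. -/
theorem stmt_6 (l : ℕ) (hl : 1 ≤ l) :
    IsSYT (l : ℕ∞) (Tdiag l) ∧
    {U : ℕ × ℕ → ℕ | IsSYT (l : ℕ∞) U ∧ jdt (Box (l : ℕ∞)) U = Tdiag l}.Finite ∧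
    {U : ℕ × ℕ → ℕ | IsSYT (l : ℕ∞) U ∧ jdt (Box (l : ℕ∞)) U = Tdiag l}.ncard = l := by
  have hset : {U : ℕ × ℕ → ℕ | IsSYT (l : ℕ∞) U ∧ jdt (Box (l : ℕ∞)) U = Tdiag l} =
      UU l '' (Finset.range l : Set ℕ) := by
    ext U
    simp only [Set.mem_setOf_eq, Set.mem_image, Finset.coe_range, Set.mem_Iio]
    constructor
    · rintro ⟨h1, h2⟩
      exact U_form hl h1 h2
    · rintro ⟨r, hr, rfl⟩
      exact ⟨UU_syt hr, jdt_UU hr⟩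
  refine ⟨T_syt hl, ?_, ?_⟩
  · rw [hset]
    exact (Finset.finite_toSet _).image _
  · rw [hset, Set.ncard_image_of_injOn, Set.ncard_coe_finset, Finset.card_range]
    intro r hr s hs h
    simp at hr hs
    exact UU_inj hr hs h
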